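/- The linear map from C^∞(S¹, ℝ) to the space ℝ^ℕ of real sequences sending a smooth function α to the sequence of its derivatives at a fixed basepoint, α ↦ (α(0), α'(0), α''(0), …), is surjective, and its kernel is the subspace of smooth loops that are infinitely flat at the basepoint. -/

import Mathlib

/-- The space of smooth loops in `ℝ`, modelled as smooth `1`-periodic functions `ℝ → ℝ`. -/
def smoothLoopsR : Submodule ℝ (ℝ → ℝ) where
  carrier := {f | ContDiff ℝ (⊤ : ℕ∞) f ∧ Function.Periodic f 1}
  add_mem' hf hg := ⟨hf.1.add hg.1, hf.2.add hg.2⟩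
  zero_mem' := ⟨contDiff_const, fun _ => rfl⟩
  smul_mem' c f hf := ⟨hf.1.const_smul c, fun x => by simp only [Pi.smul_apply, hf.2 x]⟩

open Filter Topology in
/-- A smooth cutoff of the monomial `x ^ n`, supported in `[-1/4, 1/4]`. -/
theorem exists_contDiff_cutoff_pow (n : ℕ) :
    ∃ g : ℝ → ℝ, ContDiff ℝ (⊤ : ℕ∞) g ∧ (∀ x, 1 / 4 ≤ |x| → g x = 0) ∧
      (∀ k, iteratedDeriv k g 0 = if k = n then (n.factorial : ℝ) else 0) ∧
      ∀ k, ∃ C, ∀ x, |iteratedDeriv k g x| ≤ C := by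
  let φ : ContDiffBump (0 : ℝ) := ⟨1 / 8, 1 / 4, by norm_num, by norm_num⟩
  have hg : ContDiff ℝ (⊤ : ℕ∞) fun x => φ x * x ^ n := φ.contDiff.mul (contDiff_id.pow n)
  refine ⟨fun x => φ x * x ^ n, hg, fun x hx => ?_, fun k => ?_, fun k => ?_⟩
  · have : φ x = 0 := φ.zero_of_le_dist (by simpa [φ] using hx)
    simp [this]
  · have h : (fun x => φ x * x ^ n) =ᶠ[𝓝 0] fun x => x ^ n := by
      filter_upwards [φ.eventuallyEq_one] with x hx
      simp [hx]
    rw [h.iteratedDeriv_eq k, iteratedDeriv_fun_pow_zero]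
    split_ifs <;> simp
  · have hc : HasCompactSupport fun x => φ x * x ^ n := φ.hasCompactSupport.mul_right
    obtain ⟨C, hC⟩ := (hg.continuous_iteratedFDeriv (m := k)
      (mod_cast le_top)).bounded_above_of_compact_support (hc.iteratedFDeriv (𝕜 := ℝ) k)
    exact ⟨C, fun x => by
      simpa [norm_iteratedFDeriv_eq_norm_iteratedDeriv] using hC x⟩

/-- A smooth function whose only nonzero derivative at `0` is the `n`-th one, with prescribed
value, and whose lower-order derivatives are uniformly small. -/
theorem exists_contDiff_single_iteratedDeriv (a : ℝ) (n : ℕ) :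
    ∃ f : ℝ → ℝ, ContDiff ℝ (⊤ : ℕ∞) f ∧ (∀ x, 1 / 4 ≤ |x| → f x = 0) ∧
      (∀ k, iteratedDeriv k f 0 = if k = n then a else 0) ∧
      ∃ v : ℕ → ℝ, (∀ k x, |iteratedDeriv k f x| ≤ v k) ∧ ∀ k < n, v k ≤ (1 / 2) ^ n := by
  obtain ⟨g, hg, hsupp, hder, hbdd⟩ := exists_contDiff_cutoff_pow n
  choose C hC using hbdd
  have hC0 : ∀ k, 0 ≤ C k := fun k => (abs_nonneg _).trans (hC k 0)
  set c : ℝ := a / n.factorial with hc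
  set S : ℝ := ∑ i ∈ Finset.range n, C i
  have hS : 0 ≤ S := Finset.sum_nonneg fun i _ => hC0 i
  set r : ℝ := 1 + 2 ^ n * (|c| * S)
  have hr1 : 1 ≤ r := by
    have : 0 ≤ 2 ^ n * (|c| * S) := by positivity
    linarith
  have hr0 : 0 < r := by linarith
  have hf : ∀ k x, iteratedDeriv k (fun x => c / r ^ n * g (r * x)) x =
      c / r ^ n * (r ^ k * iteratedDeriv k g (r * x)) := fun k x => by
    rw [iteratedDeriv_const_mul_field,
      iteratedDeriv_comp_const_mul (hg.of_le (mod_cast le_top))]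
  refine ⟨fun x => c / r ^ n * g (r * x), contDiff_const.mul (hg.comp (contDiff_const.mul
    contDiff_id)), fun x hx => ?_, fun k => ?_, fun k => |c| / r ^ n * (r ^ k * C k),
    fun k x => ?_, fun k hk => ?_⟩
  · have : 1 / 4 ≤ |r * x| := by
      rw [abs_mul, abs_of_pos hr0]
      nlinarith [abs_nonneg x]
    simp [hsupp _ this]
  · rw [hf, mul_zero, hder]
    split_ifs with h
    · subst h
      have : (k.factorial : ℝ) ≠ 0 := by positivity
      rw [hc]
      field_simp
    · simp
  · rw [hf, abs_mul, abs_mul, abs_div, abs_of_pos (pow_pos hr0 n), abs_of_pos (pow_pos hr0 k)]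
    beta_reduce
    gcongr
    exact hC k _
  · have hCS : C k ≤ S :=
      Finset.single_le_sum (f := C) (fun i _ => hC0 i) (Finset.mem_range.2 hk)
    have hpow : r ^ k * r ≤ r ^ n := by
      rw [← pow_succ]
      exact pow_le_pow_right₀ hr1 hk
    have hsmall : |c| * C k * 2 ^ n ≤ r := by
      have : |c| * C k ≤ |c| * S := by gcongr
      have h2 : |c| * C k * 2 ^ n ≤ |c| * S * 2 ^ n := by gcongr
      linarith
    beta_reduce
    rw [one_div, inv_pow, div_mul_eq_mul_div, div_le_iff₀ (by positivity), ← div_eq_inv_mul,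
      le_div_iff₀ (by positivity)]
    calc |c| * (r ^ k * C k) * 2 ^ n = r ^ k * (|c| * C k * 2 ^ n) := by ring
      _ ≤ r ^ k * r := by gcongr
      _ ≤ r ^ n := hpow

/-- **Borel's theorem**: every real sequence is the sequence of derivatives at `0` of a smooth
function, which may be taken supported in `[-1/4, 1/4]`. -/
theorem exists_contDiff_iteratedDeriv_zero_eq (a : ℕ → ℝ) :
    ∃ f : ℝ → ℝ, ContDiff ℝ (⊤ : ℕ∞) f ∧ (∀ x, 1 / 4 ≤ |x| → f x = 0) ∧
      ∀ k, iteratedDeriv k f 0 = a k := by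
  choose f hf hsupp hder v hv hsmall using fun n => exists_contDiff_single_iteratedDeriv (a n) n
  have hsum : ∀ k : ℕ, (k : ℕ∞) ≤ ⊤ → Summable fun n => v n k := fun k _ => by
    refine Summable.of_norm_bounded_eventually_nat
      (summable_geometric_of_lt_one (by norm_num) (by norm_num : (1 / 2 : ℝ) < 1)) ?_
    filter_upwards [Filter.eventually_gt_atTop k] with n hn
    rw [Real.norm_of_nonneg ((abs_nonneg _).trans (hv n k 0))]
    exact hsmall n k hn
  have hbound : ∀ (k n : ℕ) (x : ℝ), (k : ℕ∞) ≤ ⊤ → ‖iteratedFDeriv ℝ k (f n) x‖ ≤ v n k :=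
    fun k n x _ => by
      rw [norm_iteratedFDeriv_eq_norm_iteratedDeriv]
      exact hv n k x
  refine ⟨fun x => ∑' n, f n x, contDiff_tsum hf hsum hbound, fun x hx => ?_, fun k => ?_⟩
  · simp [hsupp _ x hx]
  · rw [iteratedDeriv_eq_iteratedFDeriv, iteratedFDeriv_tsum_apply hf hsum hbound le_top,
      tsum_eq_single k, ← iteratedDeriv_eq_iteratedFDeriv, hder, if_pos rfl]
    intro n hn
    rw [← norm_eq_zero, norm_iteratedFDeriv_eq_norm_iteratedDeriv, hder, if_neg hn.symm, norm_zero]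

open Filter Topology in
/-- A smooth function supported in `[-1/4, 1/4]` extends to a smooth `1`-periodic function with
the same germ at `0`. -/
theorem exists_smooth_periodic_eventuallyEq {f : ℝ → ℝ} (hf : ContDiff ℝ (⊤ : ℕ∞) f)
    (hsupp : ∀ x, 1 / 4 ≤ |x| → f x = 0) :
    ∃ F : ℝ → ℝ, ContDiff ℝ (⊤ : ℕ∞) F ∧ Function.Periodic F 1 ∧ F =ᶠ[𝓝 0] f := by
  have key : ∀ x₀ : ℝ, (fun x => f (x - round x)) =ᶠ[𝓝 x₀] fun x => f (x - round x₀) := by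
    intro x₀
    filter_upwards [Metric.ball_mem_nhds x₀ (by norm_num : (0 : ℝ) < 1 / 4)] with x hx
    rw [Metric.mem_ball, Real.dist_eq] at hx
    by_cases h : round x = round x₀
    · rw [h]
    · have h1 : (1 : ℝ) ≤ |(round x : ℝ) - round x₀| := by
        exact_mod_cast Int.one_le_abs (sub_ne_zero.2 h)
      have h2 := abs_sub_round x₀
      have h3 := abs_sub_round x
      have h4 : |x - round x₀| ≤ |x - x₀| + |x₀ - round x₀| := abs_sub_le _ _ _
      have h5 : |(round x : ℝ) - round x₀| ≤ |round x - x| + |x - round x₀| := abs_sub_le _ _ _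
      rw [abs_sub_comm _ x] at h5
      rw [hsupp _ (by linarith), hsupp _ (by linarith)]
  refine ⟨fun x => f (x - round x), contDiff_iff_contDiffAt.2 fun x₀ => ?_, fun x => ?_, ?_⟩
  · exact ((hf.comp (contDiff_id.sub contDiff_const)).contDiffAt).congr_of_eventuallyEq (key x₀)
  · simp [round_add_one]
  · simpa using key 0

/-- The linear map `C^∞(S¹,ℝ) → ℝ^ℕ` sending a smooth loop to the sequence of its
derivatives at the basepoint is surjective, with kernel the loops infinitely flat at the
basepoint. -/
theorem taylor_at_basepoint_surjective :
    ∃ T : smoothLoopsR →ₗ[ℝ] (ℕ → ℝ),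
      (∀ (f : smoothLoopsR) (k : ℕ), T f k = iteratedDeriv k f.1 0) ∧
      Function.Surjective T ∧
      ∀ f : smoothLoopsR, T f = 0 ↔ ∀ k : ℕ, iteratedDeriv k f.1 0 = 0 := by
  refine ⟨{ toFun := fun f k => iteratedDeriv k f.1 0
            map_add' := fun f g => funext fun k => ?_
            map_smul' := fun c f => funext fun k => ?_ }, fun _ _ => rfl, fun a => ?_,
    fun f => funext_iff⟩
  · exact iteratedDeriv_add (f.2.1.contDiffAt.of_le (mod_cast le_top))
      (g.2.1.contDiffAt.of_le (mod_cast le_top))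
  · exact iteratedDeriv_const_smul_field c f.1
  · obtain ⟨f, hf, hsupp, hder⟩ := exists_contDiff_iteratedDeriv_zero_eq a
    obtain ⟨F, hF, hper, hgerm⟩ := exists_smooth_periodic_eventuallyEq hf hsupp
    exact ⟨⟨F, hF, hper⟩, funext fun k => (hgerm.iteratedDeriv_eq k).trans (hder k)⟩
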